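/- arXiv:1008.5342 — 2 statements merged into one kernel-verified Lean document; each statement's English description precedes it below -/
import Mathlib

section
/- For any analytic function g on the unit disc, ‖g‖²_{A²} ≤ ‖g‖²_{H¹}, i.e. ∫_𝔻 |g(z)|² dA(z) ≤ (sup_{0<r<1} (1/2π) ∫₀^{2π} |g(re^{iθ})| dθ)², with equality for constant functions. -/
open MeasureTheory Metric Complex
open scoped ENNReal Real

/-- The Bergman `A²` (squared) norm of `g`, with normalized area measure `(1/π) dA`. -/
noncomputable def bergmanSq (g : ℂ → ℂ) : ℝ≥0∞ :=
  ∫⁻ z in ball (0 : ℂ) 1, ENNReal.ofReal (π⁻¹ * ‖g z‖ ^ 2) ∂volume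

/-- The Hardy `H¹` norm of `g`: `sup_{0<r<1} (1/2π) ∫₀^{2π} |g(r e^{iθ})| dθ`. -/
noncomputable def hardyOne (g : ℂ → ℂ) : ℝ≥0∞ :=
  ⨆ r : {r : ℝ // 0 < r ∧ r < 1},
    ∫⁻ θ in Set.Ioc (0 : ℝ) (2 * π),
      ENNReal.ofReal ((2 * π)⁻¹ * ‖g ((r : ℝ) * Complex.exp (θ * Complex.I))‖) ∂volume

section aux

open Filter Topology

/-- normalized circle mean of `|h|` on the unit circle -/
noncomputable def meanOne (h : ℂ → ℂ) : ℝ≥0∞ :=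
  ∫⁻ θ in Set.Ioc (0 : ℝ) (2 * π),
      ENNReal.ofReal ((2 * π)⁻¹ * ‖h (Complex.exp (θ * Complex.I))‖) ∂volume

lemma coeff_ineq (q : Polynomial ℂ) (N : ℕ) (hN : q.natDegree < N) :
    ∑ n ∈ Finset.range (2 * N), ‖(q * q).coeff n‖ ^ 2 / (n + 1) ≤
      (∑ n ∈ Finset.range N, ‖q.coeff n‖ ^ 2) ^ 2 := by
  set R : Polynomial ℝ := ∑ n ∈ Finset.range N, Polynomial.monomial n (‖q.coeff n‖ ^ 2) with hR
  have hRc : ∀ n, R.coeff n = ‖q.coeff n‖ ^ 2 := by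
    intro n
    rw [hR, Polynomial.finsetSum_coeff]
    simp only [Polynomial.coeff_monomial, Finset.sum_ite_eq', Finset.mem_range]
    split_ifs with h
    · rfl
    · rw [Polynomial.coeff_eq_zero_of_natDegree_lt (by omega)]; simp
  have hRd : R.natDegree < N := by
    rcases Nat.lt_or_ge R.natDegree N with h | h
    · exact h
    · exfalso
      have h0 : R.coeff R.natDegree = 0 := by
        rw [hRc, Polynomial.coeff_eq_zero_of_natDegree_lt (by omega)]; simp
      have : R = 0 := by simpa using h0
      rw [this] at h
      simp at h
      omega
  have hRe : R.eval 1 = ∑ n ∈ Finset.range N, ‖q.coeff n‖ ^ 2 := by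
    rw [hR, Polynomial.eval_finsetSum]; simp
  have hRRe : (R * R).eval 1 = ∑ n ∈ Finset.range (2 * N), (R * R).coeff n := by
    rw [Polynomial.eval_eq_sum_range' (n := 2 * N)]
    · simp
    · have := Polynomial.natDegree_mul_le (p := R) (q := R)
      omega
  rw [← hRe, sq, ← Polynomial.eval_mul, hRRe]
  apply Finset.sum_le_sum
  intro n _
  rw [Polynomial.coeff_mul, Polynomial.coeff_mul]
  have hn : (0 : ℝ) < n + 1 := by positivity
  rw [div_le_iff₀ hn]
  calc ‖∑ x ∈ Finset.HasAntidiagonal.antidiagonal n, q.coeff x.1 * q.coeff x.2‖ ^ 2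
      ≤ (∑ x ∈ Finset.HasAntidiagonal.antidiagonal n, ‖q.coeff x.1 * q.coeff x.2‖) ^ 2 := by
        gcongr; exact norm_sum_le _ _
    _ ≤ (Finset.HasAntidiagonal.antidiagonal n).card * ∑ x ∈ Finset.HasAntidiagonal.antidiagonal n, ‖q.coeff x.1 * q.coeff x.2‖ ^ 2 :=
        sq_sum_le_card_mul_sum_sq
    _ = _ := by
        rw [Finset.Nat.card_antidiagonal, mul_comm]
        push_cast
        congr 1
        apply Finset.sum_congr rfl
        intro x _
        rw [hRc, hRc, norm_mul, mul_pow]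

lemma parseval_range (p : Polynomial ℂ) (N : ℕ) (hN : p.natDegree < N) (r : ℝ) (t : ℝ) :
    ∫ θ in t..(t + 2 * π), ‖p.eval (r * Complex.exp (θ * Complex.I))‖ ^ 2 =
      2 * π * ∑ n ∈ Finset.range N, ‖p.coeff n‖ ^ 2 * r ^ (2 * n) := by
  have h := (p.comp (Polynomial.C (r : ℂ) * Polynomial.X)).sum_sq_norm_coeff_eq_circleAverage
  have hper : Function.Periodic
      (fun θ : ℝ => ‖p.eval (r * Complex.exp (θ * Complex.I))‖ ^ 2) (2 * π) := by
    intro θ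
    simp only
    congr 4
    push_cast
    rw [add_mul, Complex.exp_add, Complex.exp_two_pi_mul_I, mul_one]
  rw [hper.intervalIntegral_add_eq t 0, zero_add]
  rw [Real.circleAverage_def] at h
  simp only [Polynomial.comp_C_mul_X_coeff, Polynomial.eval_comp, Polynomial.eval_mul,
    Polynomial.eval_C, Polynomial.eval_X, circleMap, zero_add, Complex.ofReal_one, one_mul,
    smul_eq_mul] at h
  rw [eq_inv_mul_iff_mul_eq₀ (by positivity)] at h
  rw [← h]
  congr 1
  have hsub : (p.comp (Polynomial.C (r : ℂ) * Polynomial.X)).support ⊆ Finset.range N := by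
    intro n hn
    rw [Polynomial.mem_support_iff, Polynomial.comp_C_mul_X_coeff] at hn
    rw [Finset.mem_range]
    by_contra hc
    rw [Polynomial.coeff_eq_zero_of_natDegree_lt (by omega)] at hn
    simp at hn
  rw [Finset.sum_subset hsub]
  · apply Finset.sum_congr rfl
    intro n _
    rw [norm_mul, norm_pow, Complex.norm_real, mul_pow, ← pow_mul, mul_comm n 2, pow_mul, pow_mul]
    simp
  · intro n _ hn
    rw [Polynomial.mem_support_iff, not_not, Polynomial.comp_C_mul_X_coeff] at hn
    rw [hn]; simp

lemma meanOne_sq (q : Polynomial ℂ) (N : ℕ) (hN : q.natDegree < N) :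
    meanOne (fun z => (q * q).eval z) = ENNReal.ofReal (∑ n ∈ Finset.range N, ‖q.coeff n‖ ^ 2) := by
  have h := parseval_range q N hN 1 0
  unfold meanOne
  rw [← ofReal_integral_eq_lintegral_ofReal]
  · congr 1
    rw [zero_add, intervalIntegral.integral_of_le (by positivity)] at h
    rw [integral_const_mul]
    simp only [Complex.ofReal_one, one_mul, one_pow, mul_one] at h
    simp only [Polynomial.eval_mul, norm_mul]
    simp only [← sq]
    rw [h]
    field_simp
  · apply Continuous.integrableOn_Ioc
    fun_prop
  · exact Eventually.of_forall fun x => by positivity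

lemma bergman_poly (p : Polynomial ℂ) (N : ℕ) (hN : p.natDegree < N) :
    bergmanSq (fun z => p.eval z) =
      ENNReal.ofReal (∑ n ∈ Finset.range N, ‖p.coeff n‖ ^ 2 / (n + 1)) := by
  unfold bergmanSq
  rw [← lintegral_indicator measurableSet_ball, ← Complex.lintegral_comp_polarCoord_symm,
    polarCoord_target, Measure.volume_eq_prod, ← Measure.prod_restrict, lintegral_prod]
  swap
  · apply Measurable.aemeasurable
    have : Measurable fun z : ℂ => (ball (0 : ℂ) 1).indicator
        (fun z => ENNReal.ofReal (π⁻¹ * ‖p.eval z‖ ^ 2)) z := by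
      apply Measurable.indicator _ measurableSet_ball
      apply Measurable.ennreal_ofReal
      exact Continuous.measurable (by fun_prop)
    simp only [Complex.polarCoord_symm_apply, smul_eq_mul]
    apply Measurable.mul
    · fun_prop
    · apply this.comp
      exact Continuous.measurable (by fun_prop)
  have key : ∀ r ∈ Set.Ioi (0 : ℝ), ∫⁻ θ in Set.Ioo (-π) π, ENNReal.ofReal r •
      (ball (0 : ℂ) 1).indicator (fun z => ENNReal.ofReal (π⁻¹ * ‖p.eval z‖ ^ 2))
        (Complex.polarCoord.symm (r, θ)) =
      (Set.Ioo (0 : ℝ) 1).indicator (fun r => ENNReal.ofReal (∑ n ∈ Finset.range N,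
        ‖p.coeff n‖ ^ 2 * (2 * r ^ (2 * n + 1)))) r := by
    intro r hr
    rw [Set.mem_Ioi] at hr
    by_cases h1 : r < 1
    · rw [Set.indicator_of_mem (by exact ⟨hr, h1⟩)]
      have : ∀ θ : ℝ, ENNReal.ofReal r •
          (ball (0 : ℂ) 1).indicator (fun z => ENNReal.ofReal (π⁻¹ * ‖p.eval z‖ ^ 2))
          (Complex.polarCoord.symm (r, θ)) =
          ENNReal.ofReal (r * π⁻¹ * ‖p.eval (r * Complex.exp (θ * Complex.I))‖ ^ 2) := by
        intro θ
        rw [Set.indicator_of_mem]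
        · rw [smul_eq_mul, ← ENNReal.ofReal_mul hr.le, Complex.polarCoord_symm_apply,
            Complex.exp_mul_I, mul_assoc]
          simp
        · rw [mem_ball_zero_iff, Complex.norm_polarCoord_symm, abs_of_pos hr]; exact h1
      simp_rw [this]
      rw [← ofReal_integral_eq_lintegral_ofReal]
      · congr 1
        rw [integral_const_mul, ← integral_Ioc_eq_integral_Ioo,
          ← intervalIntegral.integral_of_le (by linarith [Real.pi_pos])]
        have h := parseval_range p N hN r (-π)
        rw [show -π + 2 * π = π by ring] at h
        rw [h, Finset.mul_sum, Finset.mul_sum]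
        apply Finset.sum_congr rfl
        intro n _
        field_simp
        ring
      · apply (Continuous.integrableOn_Ioc _).mono_set Set.Ioo_subset_Ioc_self
        fun_prop
      · exact Eventually.of_forall fun x => by positivity
    · rw [Set.indicator_of_notMem (fun h => h1 h.2)]
      have : ∀ θ : ℝ, ENNReal.ofReal r •
          (ball (0 : ℂ) 1).indicator (fun z => ENNReal.ofReal (π⁻¹ * ‖p.eval z‖ ^ 2))
          (Complex.polarCoord.symm (r, θ)) = 0 := by
        intro θ
        rw [Set.indicator_of_notMem]
        · simp
        · rw [mem_ball_zero_iff, Complex.norm_polarCoord_symm, abs_of_pos hr]; exact h1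
      simp_rw [this]
      simp
  rw [setLIntegral_congr_fun measurableSet_Ioi key, lintegral_indicator measurableSet_Ioo,
    Measure.restrict_restrict measurableSet_Ioo, Set.inter_eq_left.mpr Set.Ioo_subset_Ioi_self,
    ← ofReal_integral_eq_lintegral_ofReal]
  · congr 1
    rw [← integral_Ioc_eq_integral_Ioo, ← intervalIntegral.integral_of_le (by norm_num),
      intervalIntegral.integral_finsetSum]
    · apply Finset.sum_congr rfl
      intro n _
      rw [intervalIntegral.integral_const_mul, intervalIntegral.integral_const_mul, integral_pow]
      push_cast
      field_simp
      simp
      ring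
    · intro n _
      apply Continuous.intervalIntegrable
      fun_prop
  · apply (Continuous.integrableOn_Ioc _).mono_set Set.Ioo_subset_Ioc_self
    fun_prop
  · filter_upwards [ae_restrict_mem measurableSet_Ioo] with r hr
    have := hr.1
    apply Finset.sum_nonneg
    intro n _
    positivity

lemma ineq_sq_poly (q : Polynomial ℂ) :
    bergmanSq (fun z => (q * q).eval z) ≤ (meanOne (fun z => (q * q).eval z)) ^ 2 := by
  rw [meanOne_sq q (q.natDegree + 1) (by omega),
    bergman_poly (q * q) (2 * (q.natDegree + 1))
      (by have := Polynomial.natDegree_mul_le (p := q) (q := q); omega),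
    ← ENNReal.ofReal_pow (Finset.sum_nonneg fun _ _ => by positivity)]
  exact ENNReal.ofReal_le_ofReal (coeff_ineq q _ (by omega))

lemma ineq_closure (h : ℂ → ℂ) (H : ∀ ε : ℝ, 0 < ε → ∃ k : ℂ → ℂ, Continuous k ∧
      bergmanSq k ≤ (meanOne k) ^ 2 ∧ ∀ z : ℂ, ‖z‖ ≤ 1 → ‖k z - h z‖ ≤ ε) :
    bergmanSq h ≤ (meanOne h) ^ 2 := by
  have H' : ∀ n : ℕ, ∃ k : ℂ → ℂ, Continuous k ∧
      bergmanSq k ≤ (meanOne k) ^ 2 ∧ ∀ z : ℂ, ‖z‖ ≤ 1 → ‖k z - h z‖ ≤ 1 / ((n : ℝ) + 1) :=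
    fun n => H _ (by positivity)
  choose k hkc hkq hka using H'
  have hε : Tendsto (fun n : ℕ => 1 / ((n : ℝ) + 1)) atTop (𝓝 0) :=
    tendsto_one_div_add_atTop_nhds_zero_nat
  have hpt : ∀ z ∈ ball (0 : ℂ) 1, Tendsto (fun n => k n z) atTop (𝓝 (h z)) := by
    intro z hz
    rw [mem_ball_zero_iff] at hz
    rw [tendsto_iff_norm_sub_tendsto_zero]
    exact squeeze_zero (fun n => norm_nonneg _) (fun n => hka n z hz.le) hε
  have hM : ∀ n, meanOne (k n) ≤ meanOne h + ENNReal.ofReal (1 / ((n : ℝ) + 1)) := by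
    intro n
    unfold meanOne
    calc ∫⁻ θ in Set.Ioc (0 : ℝ) (2 * π),
          ENNReal.ofReal ((2 * π)⁻¹ * ‖k n (Complex.exp (θ * Complex.I))‖)
        ≤ ∫⁻ θ in Set.Ioc (0 : ℝ) (2 * π),
          (ENNReal.ofReal ((2 * π)⁻¹ * ‖h (Complex.exp (θ * Complex.I))‖) +
            ENNReal.ofReal ((2 * π)⁻¹ * (1 / ((n : ℝ) + 1)))) := by
          apply lintegral_mono
          intro θ
          simp only
          rw [← ENNReal.ofReal_add (by positivity) (by positivity), ← mul_add]
          apply ENNReal.ofReal_le_ofReal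
          gcongr
          have h1 := hka n (Complex.exp (θ * Complex.I)) (by rw [Complex.norm_exp_ofReal_mul_I])
          have h2 := norm_sub_norm_le (k n (Complex.exp (θ * Complex.I)))
            (h (Complex.exp (θ * Complex.I)))
          linarith
      _ = _ := by
          rw [lintegral_add_right _ measurable_const, setLIntegral_const, Real.volume_Ioc,
            ← ENNReal.ofReal_mul (by positivity)]
          congr 2
          field_simp
          ring
  have hlim : Tendsto (fun n : ℕ => (meanOne h + ENNReal.ofReal (1 / ((n : ℝ) + 1))) ^ 2) atTop
      (𝓝 ((meanOne h) ^ 2)) := by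
    have h1 : Tendsto (fun n : ℕ => ENNReal.ofReal (1 / ((n : ℝ) + 1))) atTop (𝓝 0) := by
      simpa using ENNReal.tendsto_ofReal hε
    have h2 := (tendsto_const_nhds (x := meanOne h)).add h1
    rw [add_zero] at h2
    exact ((ENNReal.continuous_pow 2).tendsto _).comp h2
  calc bergmanSq h = ∫⁻ z in ball (0 : ℂ) 1,
        liminf (fun n => ENNReal.ofReal (π⁻¹ * ‖k n z‖ ^ 2)) atTop := by
        unfold bergmanSq
        apply setLIntegral_congr_fun measurableSet_ball
        intro z hz
        symm
        apply Tendsto.liminf_eq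
        apply ENNReal.tendsto_ofReal
        exact ((hpt z hz).norm.pow 2).const_mul _
    _ ≤ liminf (fun n => bergmanSq (k n)) atTop := by
        unfold bergmanSq
        apply lintegral_liminf_le
        intro n
        apply Measurable.ennreal_ofReal
        have := hkc n
        exact Continuous.measurable (by fun_prop)
    _ ≤ liminf (fun n : ℕ => (meanOne h + ENNReal.ofReal (1 / ((n : ℝ) + 1))) ^ 2) atTop := by
        refine liminf_le_liminf ?_
        exact Eventually.of_forall fun n => (hkq n).trans (by gcongr; exact hM n)
    _ = _ := hlim.liminf_eq

lemma poly_approx (f : ℂ → ℂ) (hf : DifferentiableOn ℂ f (ball (0 : ℂ) 1)) (r : ℝ) (hr0 : 0 < r)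
    (hr1 : r < 1) (ε : ℝ) (hε : 0 < ε) :
    ∃ q : Polynomial ℂ, ∀ z : ℂ, ‖z‖ ≤ 1 → ‖q.eval z - f (r * z)‖ ≤ ε := by
  obtain ⟨r1, h1, h1'⟩ := exists_between hr1
  obtain ⟨R, hR, hR'⟩ := exists_between h1'
  lift r1 to NNReal using by linarith
  lift R to NNReal using by linarith
  have hd : DifferentiableOn ℂ f (closedBall 0 R) := by
    apply hf.mono
    exact closedBall_subset_ball hR'
  have hs := hd.hasFPowerSeriesOnBall (by
    have : (0 : ℝ) < R := by linarith
    exact_mod_cast this)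
  have ht := hs.tendstoUniformlyOn (r' := r1) (by exact_mod_cast hR)
  rw [Metric.tendstoUniformlyOn_iff] at ht
  obtain ⟨n, hn⟩ := (ht ε hε).exists
  refine ⟨∑ i ∈ Finset.range n, Polynomial.C ((cauchyPowerSeries f 0 R).coeff i * r ^ i) *
    Polynomial.X ^ i, ?_⟩
  intro z hz
  have := hn (r * z) (by
    rw [mem_ball_zero_iff, norm_mul, Complex.norm_real, Real.norm_of_nonneg hr0.le]
    nlinarith)
  rw [zero_add, dist_comm, dist_eq_norm] at this
  refine le_trans (le_of_eq ?_) this.le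
  congr 2
  rw [Polynomial.eval_finsetSum, FormalMultilinearSeries.partialSum]
  apply Finset.sum_congr rfl
  intro i _
  rw [FormalMultilinearSeries.apply_eq_pow_smul_coeff]
  simp
  ring

lemma ineq_of_sqrt (F f : ℂ → ℂ) (hF : Continuous F) (hf : DifferentiableOn ℂ f (ball (0 : ℂ) 1))
    (hfF : ∀ z ∈ ball (0 : ℂ) 1, f z * f z = F z) : bergmanSq F ≤ (meanOne F) ^ 2 := by
  have step1 : ∀ r : ℝ, 0 < r → r < 1 →
      bergmanSq (fun z => F (r * z)) ≤ (meanOne (fun z => F (r * z))) ^ 2 := by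
    intro r hr0 hr1
    have hmem : ∀ z : ℂ, ‖z‖ ≤ 1 → r * z ∈ ball (0 : ℂ) 1 := by
      intro z hz
      rw [mem_ball_zero_iff, norm_mul, Complex.norm_real, Real.norm_of_nonneg hr0.le]
      nlinarith [norm_nonneg z]
    have hcont : ContinuousOn (fun z => f (r * z)) (closedBall (0 : ℂ) 1) := by
      apply hf.continuousOn.comp (by fun_prop)
      intro z hz
      exact hmem z (by simpa using hz)
    obtain ⟨B, hB⟩ := (isCompact_closedBall (0 : ℂ) 1).exists_bound_of_continuousOn hcont
    have hB0 : 0 ≤ B := (norm_nonneg _).trans (hB 0 (by simp))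
    apply ineq_closure
    intro ε hε
    obtain ⟨q, hq⟩ := poly_approx f hf r hr0 hr1 (min 1 (ε / (2 * B + 1)))
      (lt_min one_pos (by positivity))
    refine ⟨fun z => (q * q).eval z, by fun_prop, ineq_sq_poly q, ?_⟩
    intro z hz
    have h1 := hq z hz
    have h2 := hB z (by simpa using hz)
    simp only [Polynomial.eval_mul]
    rw [← hfF _ (hmem z hz)]
    set a := q.eval z
    set b := f (r * z)
    have h3 : ‖a + b‖ ≤ 2 * B + 1 := by
      have e : a + b = (a - b) + b + b := by ring
      have := norm_add₃_le (a := a - b) (b := b) (c := b)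
      have := h1.trans (min_le_left _ _)
      rw [e]
      linarith
    rw [show a * a - b * b = (a - b) * (a + b) by ring, norm_mul]
    calc ‖a - b‖ * ‖a + b‖ ≤ (ε / (2 * B + 1)) * (2 * B + 1) := by
          gcongr
          exact h1.trans (min_le_right _ _)
      _ = ε := by field_simp
  apply ineq_closure
  intro ε hε
  have huc : UniformContinuousOn F (closedBall (0 : ℂ) 1) :=
    (isCompact_closedBall (0 : ℂ) 1).uniformContinuousOn_of_continuous hF.continuousOn
  rw [Metric.uniformContinuousOn_iff_le] at huc
  obtain ⟨δ, hδ, hd⟩ := huc ε hε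
  set r : ℝ := 1 - min δ (1 / 2) with hr
  have hm1 : min δ (1 / 2) ≤ δ := min_le_left _ _
  have hm2 : min δ (1 / 2) ≤ 1 / 2 := min_le_right _ _
  have hm3 : 0 < min δ (1 / 2) := lt_min hδ (by norm_num)
  refine ⟨fun z => F (r * z), by fun_prop, step1 r (by linarith) (by linarith), ?_⟩
  intro z hz
  rw [← dist_eq_norm]
  have hr0 : 0 ≤ r := by linarith
  apply hd
  · rw [mem_closedBall_zero_iff, norm_mul, Complex.norm_real, Real.norm_of_nonneg hr0]
    nlinarith [norm_nonneg z]
  · simpa using hz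
  · rw [dist_eq_norm, show (r : ℂ) * z - z = ((r - 1 : ℝ) : ℂ) * z by push_cast; ring, norm_mul,
      Complex.norm_real, Real.norm_eq_abs, abs_of_nonpos (by linarith)]
    nlinarith [norm_nonneg z]

/-- one-factor domination -/
lemma factor_dom (a : ℂ) : ∃ F f : ℂ → ℂ, Continuous F ∧ DifferentiableOn ℂ f (ball (0 : ℂ) 1) ∧
    (∀ z ∈ ball (0 : ℂ) 1, f z * f z = F z) ∧ (∀ z ∈ ball (0 : ℂ) 1, ‖z - a‖ ≤ ‖F z‖) ∧
    ∀ z : ℂ, ‖z‖ = 1 → ‖z - a‖ = ‖F z‖ := by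
  -- generic square root
  have hsq : ∀ c b : ℂ, ‖b‖ ≤ 1 → ∃ f : ℂ → ℂ, DifferentiableOn ℂ f (ball (0 : ℂ) 1) ∧
      ∀ z ∈ ball (0 : ℂ) 1, f z * f z = c * (1 - b * z) := by
    intro c b hb
    obtain ⟨d, hd⟩ := IsAlgClosed.exists_pow_nat_eq c (n := 2) (by norm_num)
    have hslit : ∀ z ∈ ball (0 : ℂ) 1, 1 - b * z ∈ slitPlane := by
      intro z hz
      rw [mem_ball_zero_iff] at hz
      left
      have h1 := Complex.re_le_norm (b * z)
      rw [norm_mul] at h1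
      have : ‖b‖ * ‖z‖ < 1 := by nlinarith [norm_nonneg z, norm_nonneg b]
      simp only [Complex.sub_re, Complex.one_re]
      linarith
    refine ⟨fun z => d * (1 - b * z) ^ (1 / 2 : ℂ), ?_, ?_⟩
    · apply DifferentiableOn.const_mul
      apply DifferentiableOn.cpow_const (by fun_prop) hslit
    · intro z hz
      have hne := Complex.slitPlane_ne_zero (hslit z hz)
      have : (1 - b * z) ^ (1 / 2 : ℂ) * (1 - b * z) ^ (1 / 2 : ℂ) = 1 - b * z := by
        rw [← Complex.cpow_add _ _ hne]
        norm_num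
      rw [mul_mul_mul_comm, this, ← hd]
      ring
  rcases lt_or_ge ‖a‖ 1 with ha | ha
  · obtain ⟨f, hf, hf2⟩ := hsq 1 (starRingEnd ℂ a) (by rw [Complex.norm_conj]; exact ha.le)
    have hid : ∀ z : ℂ, ‖1 - starRingEnd ℂ a * z‖ ^ 2 - ‖z - a‖ ^ 2 =
        (1 - ‖a‖ ^ 2) * (1 - ‖z‖ ^ 2) := by
      intro z
      simp only [← Complex.normSq_eq_norm_sq, Complex.normSq_apply, Complex.sub_re, Complex.sub_im,
        Complex.mul_re, Complex.mul_im, Complex.conj_re, Complex.conj_im, Complex.one_re,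
        Complex.one_im]
      ring
    refine ⟨fun z => 1 * (1 - starRingEnd ℂ a * z), f, by fun_prop, hf, hf2, ?_, ?_⟩
    · intro z hz
      rw [mem_ball_zero_iff] at hz
      simp only [one_mul]
      have h1 : 0 ≤ 1 - ‖a‖ ^ 2 := by nlinarith [norm_nonneg a]
      have h2 : 0 ≤ 1 - ‖z‖ ^ 2 := by nlinarith [norm_nonneg z]
      have := hid z
      refine (sq_le_sq₀ (norm_nonneg _) (norm_nonneg _)).mp ?_
      nlinarith [mul_nonneg h1 h2]
    · intro z hz
      have := hid z
      rw [hz] at this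
      simp only [one_mul]
      rw [← sq_eq_sq₀ (norm_nonneg _) (norm_nonneg _)]
      linarith
  · have ha0 : a ≠ 0 := by
      rintro rfl
      simp at ha
      linarith
    obtain ⟨f, hf, hf2⟩ := hsq (-a) a⁻¹ (by rw [norm_inv]; exact inv_le_one_of_one_le₀ ha)
    have e : ∀ z, -a * (1 - a⁻¹ * z) = z - a := by
      intro z
      field_simp
      ring
    refine ⟨fun z => -a * (1 - a⁻¹ * z), f, by fun_prop, hf, hf2, ?_, ?_⟩
    · intro z _
      simp only [e, le_refl]
    · intro z _
      simp only [e, le_refl]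

lemma poly_dom (c : ℂ) (s : Multiset ℂ) : ∃ F f : ℂ → ℂ, Continuous F ∧
    DifferentiableOn ℂ f (ball (0 : ℂ) 1) ∧
    (∀ z ∈ ball (0 : ℂ) 1, f z * f z = F z) ∧
    (∀ z ∈ ball (0 : ℂ) 1, ‖c * (s.map fun a => z - a).prod‖ ≤ ‖F z‖) ∧
    ∀ z : ℂ, ‖z‖ = 1 → ‖c * (s.map fun a => z - a).prod‖ = ‖F z‖ := by
  induction s using Multiset.induction_on with
  | empty =>
    obtain ⟨d, hd⟩ := IsAlgClosed.exists_pow_nat_eq c (n := 2) (by norm_num)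
    refine ⟨fun _ => c, fun _ => d, by fun_prop, by fun_prop, ?_, ?_, ?_⟩
    · intro z _
      rw [← hd]; ring
    · simp
    · simp
  | cons a s ih =>
    obtain ⟨F, f, h1, h2, h3, h4, h5⟩ := ih
    obtain ⟨G, g, k1, k2, k3, k4, k5⟩ := factor_dom a
    refine ⟨fun z => G z * F z, fun z => g z * f z, by fun_prop, k2.mul h2, ?_, ?_, ?_⟩
    · intro z hz
      simp only
      rw [← h3 z hz, ← k3 z hz]; ring
    · intro z hz
      rw [Multiset.map_cons, Multiset.prod_cons, mul_left_comm, norm_mul]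
      refine le_trans ?_ (norm_mul _ _).ge
      exact mul_le_mul (k4 z hz) (h4 z hz) (norm_nonneg _) (norm_nonneg _)
    · intro z hz
      rw [Multiset.map_cons, Multiset.prod_cons, mul_left_comm, norm_mul, k5 z hz,
        h5 z hz]
      exact (norm_mul _ _).symm

lemma ineq_poly (p : Polynomial ℂ) :
    bergmanSq (fun z => p.eval z) ≤ (meanOne (fun z => p.eval z)) ^ 2 := by
  have hp : ∀ z, p.eval z = p.leadingCoeff * (p.roots.map fun a => z - a).prod := by
    intro z
    conv_lhs => rw [(IsAlgClosed.splits p).eq_prod_roots]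
    simp [Polynomial.eval_multiset_prod]
  obtain ⟨F, f, h1, h2, h3, h4, h5⟩ := poly_dom p.leadingCoeff p.roots
  have e : meanOne (fun z => p.eval z) = meanOne F := by
    unfold meanOne
    congr 1
    ext θ
    simp only [hp]
    rw [h5 _ (Complex.norm_exp_ofReal_mul_I θ)]
  rw [e]
  refine le_trans ?_ (ineq_of_sqrt F f h1 h2 h3)
  unfold bergmanSq
  apply setLIntegral_mono' measurableSet_ball
  intro z hz
  apply ENNReal.ofReal_le_ofReal
  simp only [hp]
  have := h4 z hz
  gcongr

lemma ineq_dilate (g : ℂ → ℂ) (hg : DifferentiableOn ℂ g (ball (0 : ℂ) 1)) (r : ℝ) (hr0 : 0 < r)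
    (hr1 : r < 1) :
    bergmanSq (fun z => g (r * z)) ≤ (meanOne (fun z => g (r * z))) ^ 2 := by
  apply ineq_closure
  intro ε hε
  obtain ⟨q, hq⟩ := poly_approx g hg r hr0 hr1 ε hε
  exact ⟨fun z => q.eval z, by fun_prop, ineq_poly q, hq⟩

lemma ineq_main (g : ℂ → ℂ) (hg : DifferentiableOn ℂ g (ball (0 : ℂ) 1)) :
    bergmanSq g ≤ (hardyOne g) ^ 2 := by
  set ρ : ℕ → ℝ := fun n => 1 - 1 / ((n : ℝ) + 2) with hρ
  have hρ0 : ∀ n, 0 < ρ n := by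
    intro n
    have : 1 / ((n : ℝ) + 2) < 1 := by
      rw [div_lt_one (by positivity)]
      have : (0 : ℝ) ≤ n := by positivity
      linarith
    simp only [hρ]; linarith
  have hρ1 : ∀ n, ρ n < 1 := by
    intro n
    have : 0 < 1 / ((n : ℝ) + 2) := by positivity
    simp only [hρ]; linarith
  have hρt : Tendsto ρ atTop (𝓝 1) := by
    have h1 : Tendsto (fun n : ℕ => 1 / ((n : ℝ) + 2)) atTop (𝓝 0) := by
      have := (tendsto_one_div_add_atTop_nhds_zero_nat (𝕜 := ℝ)).comp (tendsto_add_atTop_nat 1)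
      refine this.congr fun n => ?_
      simp only [Function.comp]
      push_cast
      ring
    have h2 := (tendsto_const_nhds (x := (1 : ℝ))).sub h1
    rw [sub_zero] at h2
    exact h2
  have hmem : ∀ n, ∀ z ∈ ball (0 : ℂ) 1, (ρ n : ℂ) * z ∈ ball (0 : ℂ) 1 := by
    intro n z hz
    rw [mem_ball_zero_iff] at hz ⊢
    rw [norm_mul, Complex.norm_real, Real.norm_of_nonneg (hρ0 n).le]
    nlinarith [norm_nonneg z, hρ0 n, hρ1 n]
  calc bergmanSq g = ∫⁻ z in ball (0 : ℂ) 1,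
        liminf (fun n => ENNReal.ofReal (π⁻¹ * ‖g (ρ n * z)‖ ^ 2)) atTop := by
        unfold bergmanSq
        apply setLIntegral_congr_fun measurableSet_ball
        intro z hz
        symm
        apply Tendsto.liminf_eq
        apply ENNReal.tendsto_ofReal
        have hc : ContinuousAt g z := (hg.differentiableAt (isOpen_ball.mem_nhds hz)).continuousAt
        have ht : Tendsto (fun n => (ρ n : ℂ) * z) atTop (𝓝 z) := by
          have := ((Complex.continuous_ofReal.tendsto 1).comp hρt).mul_const z
          simpa using this
        exact ((hc.tendsto.comp ht).norm.pow 2).const_mul _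
    _ ≤ liminf (fun n => bergmanSq (fun z => g (ρ n * z))) atTop := by
        unfold bergmanSq
        apply lintegral_liminf_le'
        intro n
        have hcn : ContinuousOn (fun z : ℂ => g (ρ n * z)) (ball (0 : ℂ) 1) :=
          hg.continuousOn.comp (by fun_prop) (hmem n)
        apply AEMeasurable.ennreal_ofReal
        exact ContinuousOn.aemeasurable (continuousOn_const.mul (hcn.norm.pow 2)) measurableSet_ball
    _ ≤ liminf (fun _ : ℕ => (hardyOne g) ^ 2) atTop := by
        refine liminf_le_liminf ?_
        refine Eventually.of_forall fun n => (ineq_dilate g hg (ρ n) (hρ0 n) (hρ1 n)).trans ?_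
        gcongr
        exact le_iSup (fun r : {r : ℝ // 0 < r ∧ r < 1} => ∫⁻ θ in Set.Ioc (0 : ℝ) (2 * π),
          ENNReal.ofReal ((2 * π)⁻¹ * ‖g ((r : ℝ) * Complex.exp (θ * Complex.I))‖) ∂volume)
          ⟨ρ n, hρ0 n, hρ1 n⟩
    _ = _ := by simp

lemma eq_const (c : ℂ) : bergmanSq (fun _ => c) = (hardyOne fun _ => c) ^ 2 := by
  have h1 : (hardyOne fun _ => c) = ENNReal.ofReal ‖c‖ := by
    unfold hardyOne
    have : Nonempty {r : ℝ // 0 < r ∧ r < 1} := ⟨⟨1 / 2, by norm_num, by norm_num⟩⟩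
    rw [ciSup_const, setLIntegral_const, Real.volume_Ioc, ← ENNReal.ofReal_mul (by positivity)]
    congr 1
    field_simp
    ring
  have h2 : volume (ball (0 : ℂ) 1) = ENNReal.ofReal π := by
    rw [Complex.volume_ball, ENNReal.ofReal_one, one_pow, one_mul, ← NNReal.coe_real_pi,
      ENNReal.ofReal_coe_nnreal]
  unfold bergmanSq
  rw [h1, setLIntegral_const, h2, ← ENNReal.ofReal_mul (by positivity),
    ← ENNReal.ofReal_pow (norm_nonneg _)]
  congr 1
  field_simp

end aux

/-- Isoperimetric inequality in function-theoretic form: for `g` analytic on the disc,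
`‖g‖²_{A²} ≤ ‖g‖²_{H¹}`, with equality for constant functions. -/
theorem bergman_le_hardyOne_sq
    (g : ℂ → ℂ) (hg : DifferentiableOn ℂ g (ball (0 : ℂ) 1)) :
    bergmanSq g ≤ (hardyOne g) ^ 2 ∧
      ∀ c : ℂ, bergmanSq (fun _ => c) = (hardyOne fun _ => c) ^ 2 :=
  ⟨ineq_main g hg, eq_const⟩
end

section
/- Functions in the Dirichlet space are Hölder continuous of order 1/2 with respect to the hyperbolic distance: there is a universal constant C such that for all f with finite Dirichlet integral and all z, w ∈ 𝔻, |f(z)−f(w)| ≤ C ‖f‖_{𝒟,*} d(z,w)^{1/2}, where d is the hyperbolic distance on 𝔻. -/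
open MeasureTheory Metric Complex
open scoped Real

/-- The pseudo-hyperbolic metric on the unit disc. -/
noncomputable def pseudoHyp (z w : ℂ) : ℝ := ‖(z - w) / (1 - (starRingEnd ℂ) w * z)‖

/-- The hyperbolic distance on the unit disc. -/
noncomputable def hypDist (z w : ℂ) : ℝ :=
  (1 / 2) * Real.log ((1 + pseudoHyp z w) / (1 - pseudoHyp z w))

lemma dh_polar_eq (r θ : ℝ) : Complex.polarCoord.symm (r, θ) = circleMap 0 r θ := by
  simp only [Complex.polarCoord_symm_apply, circleMap, zero_add, Complex.exp_mul_I]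
  push_cast; rfl

lemma dh_polar_integral (G : ℂ → ℂ) (hc : ContinuousOn G (ball 0 1))
    (hi : IntegrableOn G (ball 0 1) volume) :
    ∫ a in ball (0:ℂ) 1, G a
      = ∫ r in Set.Ioo (0:ℝ) 1, (r * (2 * π)) • Real.circleAverage G 0 r := by
  have hsub : Set.Ioo (0:ℝ) 1 ×ˢ Set.Ioo (-π) π ⊆ Complex.polarCoord.target := by
    rw [Complex.polarCoord_target]
    rintro ⟨r, θ⟩ ⟨h1, h2⟩
    exact ⟨h1.1, h2⟩
  have hmeas : MeasurableSet (Set.Ioo (0:ℝ) 1 ×ˢ Set.Ioo (-π) π) :=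
    measurableSet_Ioo.prod measurableSet_Ioo
  have hmt : MeasurableSet Complex.polarCoord.target := Complex.polarCoord.open_target.measurableSet
  have hmem : ∀ p ∈ Complex.polarCoord.target,
      (Complex.polarCoord.symm p ∈ ball (0:ℂ) 1 ↔ p ∈ Set.Ioo (0:ℝ) 1 ×ˢ Set.Ioo (-π) π) := by
    rintro ⟨r, θ⟩ hp
    rw [Complex.polarCoord_target] at hp
    obtain ⟨h1, h2⟩ := hp
    simp only [mem_ball_zero_iff, norm_polarCoord_symm, Set.mem_prod, Set.mem_Ioo] at *
    have h3 : 0 < r := h1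
    rw [abs_of_pos h3]
    tauto
  have hint : IntegrableOn (fun p : ℝ × ℝ => p.1 • G (Complex.polarCoord.symm p))
      (Set.Ioo (0:ℝ) 1 ×ˢ Set.Ioo (-π) π) volume := by
    constructor
    · apply ContinuousOn.aestronglyMeasurable _ hmeas
      apply ContinuousOn.smul continuousOn_fst
      apply hc.comp
      · exact Complex.polarCoord.continuousOn_symm.mono hsub
      · intro p hp
        exact (hmem p (hsub hp)).2 hp
    · rw [hasFiniteIntegral_iff_enorm]
      have h1 : ∫⁻ a in ball (0:ℂ) 1, ‖G a‖ₑ < ⊤ := hi.2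
      rw [← lintegral_indicator measurableSet_ball, ← Complex.lintegral_comp_polarCoord_symm] at h1
      refine lt_of_le_of_lt ?_ h1
      refine le_trans (le_of_eq ?_) (lintegral_mono_set hsub)
      apply setLIntegral_congr_fun hmeas
      intro p hp
      have : Complex.polarCoord.symm p ∈ ball (0:ℂ) 1 := (hmem p (hsub hp)).2 hp
      simp only [Set.indicator_of_mem this, enorm_smul, smul_eq_mul]
      rw [Real.enorm_eq_ofReal hp.1.1.le]
  rw [← integral_indicator measurableSet_ball, ← Complex.integral_comp_polarCoord_symm]
  have e1 : ∫ p in polarCoord.target, p.1 • (ball (0:ℂ) 1).indicator G (Complex.polarCoord.symm p)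
      = ∫ p in Set.Ioo (0:ℝ) 1 ×ˢ Set.Ioo (-π) π, p.1 • G (Complex.polarCoord.symm p) := by
    have hsub' : Set.Ioo (0:ℝ) 1 ×ˢ Set.Ioo (-π) π ⊆ polarCoord.target := hsub
    have hmt' : MeasurableSet polarCoord.target := hmt
    refine (setIntegral_eq_of_subset_of_forall_sdiff_eq_zero hmt' hsub' ?_).trans ?_
    · intro p hp
      have : Complex.polarCoord.symm p ∉ ball (0:ℂ) 1 := fun h => hp.2 ((hmem p hp.1).1 h)
      rw [Set.indicator_of_notMem this, smul_zero]
    · apply setIntegral_congr_fun hmeas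
      intro p hp
      have : Complex.polarCoord.symm p ∈ ball (0:ℂ) 1 := (hmem p (hsub hp)).2 hp
      simp only [Set.indicator_of_mem this]
  rw [e1]
  have := setIntegral_prod (μ := volume) (ν := volume) _ hint
  rw [← Measure.volume_eq_prod] at this
  rw [this]
  apply setIntegral_congr_fun measurableSet_Ioo
  intro r hr
  simp only [dh_polar_eq]
  rw [integral_smul, Real.circleAverage_eq_integral_add (-π)]
  rw [intervalIntegral.integral_comp_add_right (fun θ => G (circleMap 0 r θ))]
  rw [← integral_Ioc_eq_integral_Ioo, ← intervalIntegral.integral_of_le (by linarith [Real.pi_pos])]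
  rw [smul_smul, mul_assoc, mul_inv_cancel₀ (by positivity), mul_one]
  congr 2 <;> ring

lemma dh_den {z a : ℂ} (hz : ‖z‖ < 1) (ha : ‖a‖ ≤ 1) : 0 < (1 - z * a).re := by
  have h1 : ‖z * a‖ < 1 := by
    rw [norm_mul]
    nlinarith [norm_nonneg z, norm_nonneg a]
  have := (Complex.re_le_norm (z * a))
  rw [Complex.sub_re, Complex.one_re]; linarith

lemma dh_den_ne {z a : ℂ} (hz : ‖z‖ < 1) (ha : ‖a‖ ≤ 1) : 1 - z * a ≠ 0 := by
  intro h
  have := dh_den hz ha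
  rw [h] at this; simp at this

/-- reproducing formula -/
lemma dh_repr (f : ℂ → ℂ) (hf : DifferentiableOn ℂ f (ball 0 1))
    (hi : IntegrableOn (fun a => deriv f a) (ball 0 1) volume) (z : ℂ) (hz : ‖z‖ < 1) :
    IntegrableOn (fun a => deriv f a * (z / (1 - z * (starRingEnd ℂ) a))) (ball 0 1) volume ∧
    ∫ a in ball (0:ℂ) 1, deriv f a * (z / (1 - z * (starRingEnd ℂ) a)) = π * (f z - f 0) := by
  have hd : DifferentiableOn ℂ (deriv f) (ball 0 1) := hf.deriv isOpen_ball
  have hk : ContinuousOn (fun a : ℂ => z / (1 - z * (starRingEnd ℂ) a)) (closedBall 0 1) := by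
    apply ContinuousOn.div continuousOn_const
    · fun_prop
    · intro a ha
      apply dh_den_ne hz
      simpa using ha
  have hint : IntegrableOn (fun a => deriv f a * (z / (1 - z * (starRingEnd ℂ) a)))
      (ball 0 1) volume := by
    obtain ⟨M, hM⟩ := (isCompact_closedBall (0:ℂ) 1).exists_bound_of_continuousOn hk
    refine Integrable.mul_bdd (c := M) hi ?_ ?_
    · exact (hk.mono ball_subset_closedBall).aestronglyMeasurable measurableSet_ball
    · exact (ae_restrict_iff' measurableSet_ball).2
        (Filter.Eventually.of_forall fun a ha => hM a (ball_subset_closedBall ha))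
  refine ⟨hint, ?_⟩
  rw [dh_polar_integral (fun a => deriv f a * (z / (1 - z * (starRingEnd ℂ) a)))
    (hd.continuousOn.mul (hk.mono ball_subset_closedBall)) hint]
  have key : ∀ r ∈ Set.Ioo (0:ℝ) 1,
      (r * (2 * π)) • Real.circleAverage
        (fun a => deriv f a * (z / (1 - z * (starRingEnd ℂ) a))) 0 r
      = π * (deriv f (((r ^ 2 : ℝ) : ℂ) * z) * (((2 * r : ℝ) : ℂ) * z)) := by
    intro r hr
    have hw : ((r ^ 2 : ℝ) : ℂ) * z ∈ ball (0:ℂ) |r| := by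
      rw [mem_ball_zero_iff, norm_mul, Complex.norm_real, Real.norm_of_nonneg (by positivity),
        abs_of_pos hr.1]
      nlinarith [hr.1, hr.2, norm_nonneg z, mul_pos hr.1 hr.1]
    have hD : DiffContOnCl ℂ (deriv f) (ball 0 |r|) := by
      apply DifferentiableOn.diffContOnCl
      apply hd.mono
      refine closure_ball_subset_closedBall.trans (closedBall_subset_ball ?_)
      rw [abs_of_pos hr.1]; exact hr.2
    have := hD.circleAverage_smul_div hw
    have e : Real.circleAverage
        (fun a => deriv f a * (z / (1 - z * (starRingEnd ℂ) a))) 0 r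
        = Real.circleAverage
        (fun a => z • (((a - 0) / (a - ((r ^ 2 : ℝ) : ℂ) * z)) • deriv f a)) 0 r := by
      apply Real.circleAverage_congr_sphere
      intro a ha
      have ha' : ‖a‖ = r := by simpa [abs_of_pos hr.1] using ha
      have ha0 : a ≠ 0 := by
        rw [← norm_pos_iff, ha']; exact hr.1
      have h2 : ((r ^ 2 : ℝ) : ℂ) = a * (starRingEnd ℂ) a := by
        rw [Complex.mul_conj, Complex.normSq_eq_norm_sq, ha']
      have h3 : 1 - z * (starRingEnd ℂ) a ≠ 0 := by
        apply dh_den_ne hz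
        rw [RCLike.norm_conj, ha']; exact hr.2.le
      have h4 : a - a * (starRingEnd ℂ) a * z = a * (1 - z * (starRingEnd ℂ) a) := by ring
      simp only [smul_eq_mul, sub_zero]
      rw [h2, h4]
      field_simp
    rw [e, Real.circleAverage_fun_smul, this]
    simp only [smul_eq_mul, Complex.real_smul]
    push_cast; ring
  rw [setIntegral_congr_fun measurableSet_Ioo key, integral_const_mul,
    ← integral_Ioc_eq_integral_Ioo, ← intervalIntegral.integral_of_le zero_le_one]
  congr 1
  have hmem : ∀ r ∈ Set.uIcc (0:ℝ) 1, ((r ^ 2 : ℝ) : ℂ) * z ∈ ball (0:ℂ) 1 := by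
    intro r hr
    rw [Set.uIcc_of_le zero_le_one] at hr
    rw [mem_ball_zero_iff, norm_mul, Complex.norm_real, Real.norm_of_nonneg (by positivity)]
    have : r ^ 2 ≤ 1 := by nlinarith [hr.1, hr.2]
    nlinarith [norm_nonneg z]
  have := intervalIntegral.integral_eq_sub_of_hasDerivAt (a := (0:ℝ)) (b := 1)
    (f := fun r : ℝ => f (((r ^ 2 : ℝ) : ℂ) * z))
    (f' := fun r : ℝ => (deriv f (((r ^ 2 : ℝ) : ℂ) * z) * (((2 * r : ℝ) : ℂ) * z))) ?_ ?_
  · rw [this]; simp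
  · intro r hr
    have h1 : HasDerivAt f (deriv f (((r ^ 2 : ℝ) : ℂ) * z)) (((r ^ 2 : ℝ) : ℂ) * z) :=
      (hf.differentiableAt (isOpen_ball.mem_nhds (hmem r hr))).hasDerivAt
    have h2 : HasDerivAt (fun r : ℝ => ((r ^ 2 : ℝ) : ℂ) * z) (((2 * r : ℝ) : ℂ) * z) r := by
      apply HasDerivAt.mul_const
      apply HasDerivAt.ofReal_comp
      simpa using hasDerivAt_pow 2 r
    exact h1.comp r h2
  · apply ContinuousOn.intervalIntegrable
    apply ContinuousOn.mul
    · apply hd.continuousOn.comp (by fun_prop)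
      exact hmem
    · fun_prop

lemma dh_integrable (f : ℂ → ℂ) (hf : DifferentiableOn ℂ f (ball 0 1))
    (hi : IntegrableOn (fun z => ‖deriv f z‖ ^ 2) (ball (0 : ℂ) 1) volume) :
    MemLp (deriv f) 2 (volume.restrict (ball (0:ℂ) 1)) ∧
      IntegrableOn (fun a => deriv f a) (ball 0 1) volume := by
  have hm : AEStronglyMeasurable (deriv f) (volume.restrict (ball (0:ℂ) 1)) :=
    (hf.deriv isOpen_ball).continuousOn.aestronglyMeasurable measurableSet_ball
  have h2 : MemLp (deriv f) 2 (volume.restrict (ball (0:ℂ) 1)) :=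
    (memLp_two_iff_integrable_sq_norm hm).2 hi
  have : IsFiniteMeasure (volume.restrict (ball (0:ℂ) 1)) :=
    ⟨by rw [Measure.restrict_apply_univ]; exact measure_ball_lt_top⟩
  exact ⟨h2, h2.integrable (by norm_num)⟩

/-- conjugate of the derivative of the kernel difference -/
noncomputable def dhK (z w a : ℂ) : ℂ :=
  z / (1 - z * (starRingEnd ℂ) a) - w / (1 - w * (starRingEnd ℂ) a)

lemma dh_repr2 (f : ℂ → ℂ) (hf : DifferentiableOn ℂ f (ball 0 1))
    (hi : IntegrableOn (fun a => deriv f a) (ball 0 1) volume) (z w : ℂ) (hz : ‖z‖ < 1)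
    (hw : ‖w‖ < 1) :
    ∫ a in ball (0:ℂ) 1, deriv f a * dhK z w a = π * (f z - f w) := by
  obtain ⟨i1, e1⟩ := dh_repr f hf hi z hz
  obtain ⟨i2, e2⟩ := dh_repr f hf hi w hw
  have : ∀ a, deriv f a * dhK z w a = deriv f a * (z / (1 - z * (starRingEnd ℂ) a))
      - deriv f a * (w / (1 - w * (starRingEnd ℂ) a)) := fun a => by rw [dhK, mul_sub]
  simp_rw [this]
  rw [integral_sub i1 i2, e1, e2]
  ring

/-- the kernel difference -/
noncomputable def dhk (z w a : ℂ) : ℂ :=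
  Complex.log (1 - (starRingEnd ℂ) w * a) - Complex.log (1 - (starRingEnd ℂ) z * a)

lemma dhk_hasDeriv (z w a : ℂ) (hz : ‖z‖ < 1) (hw : ‖w‖ < 1) (ha : ‖a‖ ≤ 1) :
    HasDerivAt (dhk z w) ((starRingEnd ℂ) (dhK z w a)) a := by
  have aux : ∀ u : ℂ, ‖u‖ < 1 → HasDerivAt (fun a => Complex.log (1 - (starRingEnd ℂ) u * a))
      (-(starRingEnd ℂ) u / (1 - (starRingEnd ℂ) u * a)) a := by
    intro u hu
    have h1 : HasDerivAt (fun a => 1 - (starRingEnd ℂ) u * a) (-(starRingEnd ℂ) u) a := by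
      simpa using ((hasDerivAt_id a).const_mul ((starRingEnd ℂ) u)).const_sub 1
    exact h1.clog (Or.inl (dh_den (by rwa [RCLike.norm_conj]) ha))
  have := (aux w hw).sub (aux z hz)
  refine this.congr_deriv ?_
  simp only [dhK, map_sub, map_div₀, map_mul, map_one, Complex.conj_conj]
  ring

lemma dhK_cont (z w : ℂ) (hz : ‖z‖ < 1) (hw : ‖w‖ < 1) :
    ContinuousOn (dhK z w) (closedBall 0 1) := by
  have aux : ∀ u : ℂ, ‖u‖ < 1 → ContinuousOn (fun a : ℂ => u / (1 - u * (starRingEnd ℂ) a))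
      (closedBall 0 1) := by
    intro u hu
    apply ContinuousOn.div continuousOn_const
    · fun_prop
    · intro a ha
      apply dh_den_ne hu
      simpa using ha
  exact (aux z hz).sub (aux w hw)

lemma dhK_norm (z w : ℂ) (hz : ‖z‖ < 1) (hw : ‖w‖ < 1) :
    ∫ a in ball (0:ℂ) 1, ‖dhK z w a‖ ^ 2 = π * (dhk z w z - dhk z w w).re := by
  have hdiff : DifferentiableOn ℂ (dhk z w) (ball 0 1) := fun a ha =>
    (dhk_hasDeriv z w a hz hw (by simpa using (mem_ball_zero_iff.1 ha).le)).differentiableAt.differentiableWithinAt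
  have hder : ∀ a ∈ ball (0:ℂ) 1, deriv (dhk z w) a = (starRingEnd ℂ) (dhK z w a) := fun a ha =>
    (dhk_hasDeriv z w a hz hw (by simpa using (mem_ball_zero_iff.1 ha).le)).deriv
  have hint : IntegrableOn (fun a => deriv (dhk z w) a) (ball 0 1) volume := by
    have h1 : IntegrableOn (fun a => (starRingEnd ℂ) (dhK z w a)) (ball 0 1) volume :=
      ((Complex.continuous_conj.comp_continuousOn
        (dhK_cont z w hz hw)).integrableOn_compact (isCompact_closedBall 0 1)).mono_set
        ball_subset_closedBall
    exact h1.congr_fun (fun a ha => (hder a ha).symm) measurableSet_ball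
  have := dh_repr2 _ hdiff hint z w hz hw
  have e : ∫ a in ball (0:ℂ) 1, deriv (dhk z w) a * dhK z w a
      = ∫ a in ball (0:ℂ) 1, ((‖dhK z w a‖ ^ 2 : ℝ) : ℂ) := by
    apply setIntegral_congr_fun measurableSet_ball
    intro a ha
    simp only [hder a ha]
    rw [mul_comm, Complex.mul_conj, Complex.normSq_eq_norm_sq]
  rw [e, integral_complex_ofReal] at this
  have h := congrArg Complex.re this
  rw [Complex.re_ofReal_mul] at h
  exact h

lemma dhk_val (z w : ℂ) (hz : ‖z‖ < 1) (hw : ‖w‖ < 1) :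
    (dhk z w z - dhk z w w).re ≤ 2 * hypDist z w := by
  have nz : ∀ u : ℂ, ‖u‖ < 1 → ‖1 - (starRingEnd ℂ) u * u‖ = 1 - ‖u‖ ^ 2 := by
    intro u hu
    rw [mul_comm, Complex.mul_conj, Complex.normSq_eq_norm_sq, ← Complex.ofReal_one,
      ← Complex.ofReal_sub, Complex.norm_real, Real.norm_of_nonneg]
    nlinarith [norm_nonneg u]
  have nc : ‖1 - (starRingEnd ℂ) z * w‖ = ‖1 - (starRingEnd ℂ) w * z‖ := by
    rw [← RCLike.norm_conj]
    simp only [map_sub, map_mul, map_one, Complex.conj_conj]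
    rw [mul_comm]
  have hpos : 0 < ‖1 - (starRingEnd ℂ) w * z‖ :=
    norm_pos_iff.2 (dh_den_ne (by rwa [RCLike.norm_conj]) hz.le)
  have hz2 : 0 < 1 - ‖z‖ ^ 2 := by nlinarith [norm_nonneg z]
  have hw2 : 0 < 1 - ‖w‖ ^ 2 := by nlinarith [norm_nonneg w]
  have id1 : ‖1 - (starRingEnd ℂ) w * z‖ ^ 2 - ‖z - w‖ ^ 2 = (1 - ‖z‖ ^ 2) * (1 - ‖w‖ ^ 2) := by
    simp only [← Complex.normSq_eq_norm_sq, Complex.normSq_apply]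
    simp
    ring
  have hre : (dhk z w z - dhk z w w).re
      = Real.log (‖1 - (starRingEnd ℂ) w * z‖ ^ 2 / ((1 - ‖z‖ ^ 2) * (1 - ‖w‖ ^ 2))) := by
    simp only [dhk, Complex.sub_re, Complex.log_re, nz z hz, nz w hw, nc]
    rw [Real.log_div (by positivity) (by positivity), Real.log_mul hz2.ne' hw2.ne', Real.log_pow]
    push_cast; ring
  rw [hre]
  unfold hypDist
  have hρ : pseudoHyp z w = ‖z - w‖ / ‖1 - (starRingEnd ℂ) w * z‖ := by
    rw [pseudoHyp, norm_div]
  rw [← id1, hρ]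
  set A := ‖1 - (starRingEnd ℂ) w * z‖
  set B := ‖z - w‖
  have hB : 0 ≤ B := norm_nonneg _
  have hAB : 0 < A ^ 2 - B ^ 2 := by rw [id1]; exact mul_pos hz2 hw2
  have hlt : B < A := by nlinarith
  have e : (1 + B / A) / (1 - B / A) = (A + B) / (A - B) := by
    have : A - B ≠ 0 := by linarith
    field_simp
  rw [e]
  have : A ^ 2 / (A ^ 2 - B ^ 2) ≤ (A + B) / (A - B) := by
    rw [div_le_div_iff₀ hAB (by linarith)]
    have : 0 < A - B := by linarith
    nlinarith [mul_nonneg this.le (mul_nonneg hpos.le hB), mul_nonneg this.le (mul_nonneg hB hB)]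
  have := Real.log_le_log (by positivity) this
  linarith

/-- Dirichlet functions are Hölder continuous of order `1/2` for the hyperbolic metric:
`|f(z) - f(w)| ≤ C ‖f‖_{𝒟,*} d(z,w)^{1/2}` with a universal constant `C`. -/
theorem dirichlet_hyperbolic_holder :
    ∃ C : ℝ, 0 < C ∧
      ∀ f : ℂ → ℂ, DifferentiableOn ℂ f (ball (0 : ℂ) 1) →
        IntegrableOn (fun z => ‖deriv f z‖ ^ 2) (ball (0 : ℂ) 1) volume →
        ∀ z ∈ ball (0 : ℂ) 1, ∀ w ∈ ball (0 : ℂ) 1,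
          ‖f z - f w‖ ≤
            C * Real.sqrt (∫ z in ball (0 : ℂ) 1, π⁻¹ * ‖deriv f z‖ ^ 2 ∂volume) *
              Real.sqrt (hypDist z w) := by
  refine ⟨√2, by positivity, ?_⟩
  intro f hf hi z hz w hw
  rw [mem_ball_zero_iff] at hz hw
  obtain ⟨hL, hint⟩ := dh_integrable f hf hi
  have hrep := dh_repr2 f hf hint z w hz hw
  have hK2 : MemLp (dhK z w) 2 (volume.restrict (ball (0:ℂ) 1)) := by
    have hc := dhK_cont z w hz hw
    refine (memLp_two_iff_integrable_sq_norm
      ((hc.mono ball_subset_closedBall).aestronglyMeasurable measurableSet_ball)).2 ?_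
    exact ((hc.norm.pow 2).integrableOn_compact (isCompact_closedBall 0 1)).mono_set
        ball_subset_closedBall
  have hCS := integral_mul_norm_le_Lp_mul_Lq (p := 2) (q := 2)
    (μ := volume.restrict (ball (0:ℂ) 1)) Real.HolderConjugate.two_two
    (f := deriv f) (g := dhK z w) (by simpa using hL) (by simpa using hK2)
  simp only [Real.rpow_two, ← Real.sqrt_eq_rpow] at hCS
  have h1 : π * ‖f z - f w‖ ≤ ∫ a in ball (0:ℂ) 1, ‖deriv f a‖ * ‖dhK z w a‖ := by
    have := norm_integral_le_integral_norm (μ := volume.restrict (ball (0:ℂ) 1))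
      (fun a => deriv f a * dhK z w a)
    rw [hrep, norm_mul, Complex.norm_real, Real.norm_of_nonneg Real.pi_pos.le] at this
    simpa only [norm_mul] using this
  rw [dhK_norm z w hz hw] at hCS
  have h2 := dhk_val z w hz hw
  rw [integral_const_mul]
  set D := ∫ a in ball (0:ℂ) 1, ‖deriv f a‖ ^ 2
  have h3 : √D * √(π * (dhk z w z - dhk z w w).re) ≤ √D * √(π * (2 * hypDist z w)) := by
    gcongr
  have h4 : √D * √(π * (2 * hypDist z w)) = π * (√2 * √(π⁻¹ * D) * √(hypDist z w)) := by
    have hs : √π * √π = π := Real.mul_self_sqrt Real.pi_pos.le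
    have hs0 : √π ≠ 0 := by positivity
    rw [Real.sqrt_mul Real.pi_pos.le, Real.sqrt_mul zero_le_two,
      Real.sqrt_mul (inv_nonneg.2 Real.pi_pos.le), Real.sqrt_inv]
    nth_rewrite 2 [← hs]
    field_simp
  exact le_of_mul_le_mul_left ((h1.trans hCS).trans (h3.trans h4.le)) Real.pi_pos
end
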